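/- arXiv:1608.04880 — 4 statements merged into one kernel-verified Lean document; each statement's English description precedes it below -/
import Mathlib

section
/- Given the assumptions N₀ > 1 and Y* < γM*, the uncontrolled model dI/dt = b(1 - I/K)F - (ν_I + μ_I)I, dY/dt = rν_I I - ν_Y min{γM/Y, 1}Y + δF - μ_Y Y, dF/dt = ν_Y min{γM/Y, 1}Y - (δ + μ_F)F, dM/dt = (1 - r)ν_I I - μ_M M has exactly two equilibria: TE = (0,0,0,0), which is unstable, and EE* = (I*,Y*,F*,M*), which is asymptotically stable. -/
open Filter Topology Set

noncomputable section

/-- `x` is a (forward) solution of `x' = f x` for `t ≥ 0` remaining in `S`. -/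
def IsSolOn (f : (Fin 4 → ℝ) → (Fin 4 → ℝ)) (S : Set (Fin 4 → ℝ))
    (x : ℝ → Fin 4 → ℝ) : Prop :=
  (∀ t : ℝ, 0 ≤ t → HasDerivAt x (f (x t)) t) ∧ ∀ t : ℝ, 0 ≤ t → x t ∈ S

/-- The nonnegative orthant ℝ⁴₊. -/
def Orthant : Set (Fin 4 → ℝ) := {x | ∀ i, 0 ≤ x i}

/-- Lyapunov stability of `p` relative to forward solutions in `S`. -/
def StableOn (f : (Fin 4 → ℝ) → (Fin 4 → ℝ)) (S : Set (Fin 4 → ℝ)) (p : Fin 4 → ℝ) : Prop :=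
  ∀ ε > 0, ∃ d > 0, ∀ x : ℝ → Fin 4 → ℝ, IsSolOn f S x → dist (x 0) p < d →
    ∀ t : ℝ, 0 ≤ t → dist (x t) p < ε

/-- (Local) asymptotic stability of `p` relative to forward solutions in `S`. -/
def AsympStableOn (f : (Fin 4 → ℝ) → (Fin 4 → ℝ)) (S : Set (Fin 4 → ℝ))
    (p : Fin 4 → ℝ) : Prop :=
  f p = 0 ∧ StableOn f S p ∧
    ∃ d > 0, ∀ x : ℝ → Fin 4 → ℝ, IsSolOn f S x → dist (x 0) p < d →
      Tendsto x atTop (𝓝 p)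

/-- The vector field of the full uncontrolled model, with fertilisation rate
`ν_Y min{γM/Y, 1}`. -/
def fullModel (b K γ r νI μI νY μY δ μF μM : ℝ) : (Fin 4 → ℝ) → (Fin 4 → ℝ) := fun x =>
  ![b * (1 - x 0 / K) * x 2 - (νI + μI) * x 0,
    r * νI * x 0 - νY * min (γ * x 3 / x 1) 1 * x 1 + δ * x 2 - μY * x 1,
    νY * min (γ * x 3 / x 1) 1 * x 1 - (δ + μF) * x 2,
    (1 - r) * νI * x 0 - μM * x 3]


theorem trap_nonneg {ι : Type} [Finite ι] (u u' : ι → ℝ → ℝ)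
    (hd : ∀ i t, 0 ≤ t → HasDerivAt (u i) (u' i t) t) (h0 : ∀ i, 0 ≤ u i 0)
    (h : ∀ t, 0 ≤ t → (∀ j, 0 ≤ u j t) → ∀ i, u i t = 0 → 0 < u' i t) :
    ∀ t, 0 ≤ t → ∀ i, 0 ≤ u i t := by
  intro T hT
  have key : Icc 0 T ⊆ {t | ∀ i, 0 ≤ u i t} := by
    apply IsClosed.Icc_subset_of_forall_exists_gt
    · have : {t | ∀ i, 0 ≤ u i t} ∩ Icc 0 T = (⋂ i, (Icc 0 T ∩ u i ⁻¹' Ici 0)) ∩ Icc 0 T := by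
        ext t
        simp only [mem_inter_iff, mem_iInter, mem_preimage, mem_Ici, mem_ofPred_eq]
        exact ⟨fun h => ⟨fun i => ⟨h.2, h.1 i⟩, h.2⟩, fun h => ⟨fun i => (h.1 i).2, h.2⟩⟩
      rw [this]
      refine IsClosed.inter (isClosed_iInter fun i => ?_) isClosed_Icc
      refine ContinuousOn.preimage_isClosed_of_isClosed ?_ isClosed_Icc isClosed_Ici
      exact fun t ht => (hd i t ht.1).continuousAt.continuousWithinAt
    · exact h0
    · rintro t ⟨ht, htI⟩ y hy
      have ev : ∀ᶠ s in 𝓝[>] t, ∀ i, 0 ≤ u i s := by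
        rw [eventually_all]
        intro i
        rcases (ht i).lt_or_eq with hp | hz
        · have := (hd i t htI.1).continuousAt.eventually (lt_mem_nhds hp)
          exact (this.filter_mono nhdsWithin_le_nhds).mono fun s hs => hs.le
        · have hpos := h t htI.1 ht i hz.symm
          have hs := (hasDerivAt_iff_tendsto_slope.1 (hd i t htI.1)).mono_left
            (nhdsWithin_mono t (fun s (hs : t < s) => ne_of_gt hs))
          have := hs.eventually (lt_mem_nhds hpos)
          filter_upwards [this, self_mem_nhdsWithin] with s h1 h2
          rw [slope_def_field, ← hz, sub_zero] at h1
          have h3 : (0:ℝ) < s - t := sub_pos.2 h2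
          exact ((div_pos_iff_of_pos_right h3).1 h1).le
      have ev2 : ∀ᶠ s in 𝓝[>] t, s ∈ Ioc t y := Ioc_mem_nhdsGT hy
      exact (ev.and ev2).exists
  exact key ⟨hT, le_rfl⟩

theorem scalar_nonneg (u u' : ℝ → ℝ) (hd : ∀ t, 0 ≤ t → HasDerivAt u (u' t) t) (h0 : 0 ≤ u 0)
    (h : ∀ t, 0 ≤ t → u t < 0 → 0 ≤ u' t) : ∀ t, 0 ≤ t → 0 ≤ u t := by
  intro t ht
  by_contra hneg
  push Not at hneg
  set e := -u t / (2 * (1 + t)) with he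
  have he0 : 0 < e := by rw [he]; apply div_pos <;> linarith
  have := trap_nonneg (ι := Unit) (fun _ t => u t + e * (1 + t)) (fun _ t => u' t + e)
    (fun _ t ht => by
      have h1 : HasDerivAt (fun t : ℝ => e * (1 + t)) e t := by
        simpa using ((hasDerivAt_id t).const_add 1).const_mul e
      exact (hd t ht).add h1)
    (fun _ => by simp; linarith)
    (fun t ht _ _ hz => by
      have : 0 < e * (1 + t) := by positivity
      have := h t ht (by linarith)
      linarith) t ht ()
  have h2 : e * (1 + t) = -u t / 2 := by rw [he]; field_simp
  simp only [h2] at this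
  linarith

theorem global_exists {E : Type*} [NormedAddCommGroup E] [NormedSpace ℝ E] [CompleteSpace E]
    (g : E → E) (K L : NNReal) (hg : LipschitzWith K g) (hL : ∀ x, ‖g x‖ ≤ L) (x0 : E) :
    ∃ α : ℝ → E, α 0 = x0 ∧ ∀ t, HasDerivAt α (g (α t)) t := by
  have loc : ∀ n : ℕ, ∃ α : ℝ → E, α 0 = x0 ∧
      ∀ t ∈ Ioo (-((n:ℝ)+1)) (n+1), HasDerivAt α (g (α t)) t := by
    intro n
    have hn : (0:ℝ) ≤ n := n.cast_nonneg
    have hpl : IsPicardLindelof (fun _ => g) (tmin := -((n:ℝ)+1)) (tmax := n+1)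
        ⟨0, by constructor <;> linarith⟩ x0 (L * (n+1)) 0 L K :=
      { lipschitzOnWith := fun _ _ => hg.lipschitzOnWith
        continuousOn := fun _ _ => continuousOn_const
        norm_le := fun _ _ x _ => hL x
        mul_max_le := by simp }
    obtain ⟨α, h1, h2⟩ := hpl.exists_eq_forall_mem_Icc_hasDerivWithinAt₀
    exact ⟨α, h1, fun t ht => (h2 t (Ioo_subset_Icc_self ht)).hasDerivAt (Icc_mem_nhds ht.1 ht.2)⟩
  choose β hβ0 hβ using loc
  have agree : ∀ n m : ℕ, n ≤ m → ∀ s : ℝ, |s| < n + 1 → β n s = β m s := by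
    intro n m hnm s hs
    have hn : (0:ℝ) ≤ n := n.cast_nonneg
    have hnm' : (n:ℝ) ≤ m := by exact_mod_cast hnm
    refine ODE_solution_unique_of_mem_Ioo (v := fun _ => g) (s := fun _ => univ) (t₀ := 0)
      (a := -((n:ℝ)+1)) (b := n+1) (K := K) (fun _ _ => hg.lipschitzOnWith)
      ⟨by linarith, by linarith⟩ (fun t ht => ⟨hβ n t ht, trivial⟩)
      (fun t ht => ⟨hβ m t ⟨by linarith [ht.1], by linarith [ht.2]⟩, trivial⟩)
      (by rw [hβ0, hβ0]) (abs_lt.1 hs)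
  refine ⟨fun t => β ⌈|t|⌉₊ t, by simp [hβ0], fun t => ?_⟩
  set N := ⌈|t|⌉₊ + 1 with hN
  have h1 : |t| < N := by rw [hN]; push_cast; linarith [Nat.le_ceil |t|]
  have ev : (fun t : ℝ => β ⌈|t|⌉₊ t) =ᶠ[𝓝 t] β N := by
    have : ∀ᶠ s : ℝ in 𝓝 t, |s| < (N : ℝ) := continuous_abs.continuousAt.eventually (gt_mem_nhds h1)
    filter_upwards [this] with s hs
    exact agree _ _ (Nat.ceil_le.2 hs.le) s (by linarith [Nat.le_ceil |s|])
  have h2 := hβ N t (abs_lt.1 (by linarith))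
  rw [← ev.eq_of_nhds] at h2
  exact h2.congr_of_eventuallyEq ev

theorem small (A B : ℝ) (hB : 0 < B) : ∀ᶠ e in 𝓝[>] (0:ℝ), e * A < B := by
  have : Tendsto (fun e : ℝ => e * A) (𝓝 0) (𝓝 (0 * A)) := (continuous_id.mul continuous_const).tendsto 0
  rw [zero_mul] at this
  exact (this.eventually (gt_mem_nhds hB)).filter_mono nhdsWithin_le_nhds

/-- The model with `min (γ M) Y`. -/
def redModel (b K γ r νI μI νY μY δ μF μM : ℝ) : (Fin 4 → ℝ) → (Fin 4 → ℝ) := fun x =>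
  ![b * (1 - x 0 / K) * x 2 - (νI + μI) * x 0,
    r * νI * x 0 - νY * min (γ * x 3) (x 1) + δ * x 2 - μY * x 1,
    νY * min (γ * x 3) (x 1) - (δ + μF) * x 2,
    (1 - r) * νI * x 0 - μM * x 3]

theorem min_red {γ M Y : ℝ} (hγ : 0 < γ) (hM : 0 ≤ M) (hY : 0 ≤ Y) :
    min (γ * M / Y) 1 * Y = min (γ * M) Y := by
  rcases hY.lt_or_eq with h | h
  · rw [min_mul_of_nonneg _ _ hY, div_mul_cancel₀ _ h.ne', one_mul]
  · subst h
    simp only [mul_zero]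
    rw [min_eq_right]; positivity

theorem full_eq_red (b K γ r νI μI νY μY δ μF μM : ℝ) (hγ : 0 < γ) (x : Fin 4 → ℝ)
    (hx : x ∈ Orthant) :
    fullModel b K γ r νI μI νY μY δ μF μM x = redModel b K γ r νI μI νY μY δ μF μM x := by
  have := min_red hγ (hx 3) (hx 1)
  unfold fullModel redModel
  simp only [mul_assoc νY, this]

theorem red_lip (b K γ r νI μI νY μY δ μF μM : ℝ) :
    LocallyLipschitz (redModel b K γ r νI μI νY μY δ μF μM) := by
  have h1 : ContDiff ℝ 1 (fun x : Fin 4 → ℝ => (![b * (1 - x 0 / K) * x 2 - (νI + μI) * x 0,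
    r * νI * x 0 + δ * x 2 - μY * x 1, - (δ + μF) * x 2,
    (1 - r) * νI * x 0 - μM * x 3] : Fin 4 → ℝ)) := by
    rw [contDiff_pi]
    intro i
    fin_cases i <;> simp <;> fun_prop
  have h2 : LocallyLipschitz (fun x : Fin 4 → ℝ => min (γ * x 3) (x 1)) := by
    refine LocallyLipschitz.min ?_ ?_
    · exact ContDiff.locallyLipschitz (𝕂 := ℝ) (by fun_prop)
    · exact ContDiff.locallyLipschitz (𝕂 := ℝ) (by fun_prop)
  have h3 : LocallyLipschitz (fun t : ℝ => (![0, -νY * t, νY * t, 0] : Fin 4 → ℝ)) := by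
    refine ContDiff.locallyLipschitz (𝕂 := ℝ) ?_
    rw [contDiff_pi]
    intro i
    fin_cases i <;> simp <;> fun_prop
  have h4 := h1.locallyLipschitz.add (h3.comp h2)
  refine (congrArg LocallyLipschitz ?_).mpr h4
  funext x i
  fin_cases i <;> simp [redModel] <;> ring

theorem clamp_exists (h : (Fin 4 → ℝ) → (Fin 4 → ℝ)) (hl : LocallyLipschitz h)
    (U : Fin 4 → ℝ) (hU : ∀ i, 0 ≤ U i)
    (hlow : ∀ x : Fin 4 → ℝ, (∀ i, 0 ≤ x i ∧ x i ≤ U i) → ∀ i, x i = 0 → 0 ≤ h x i)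
    (hup : ∀ x : Fin 4 → ℝ, (∀ i, 0 ≤ x i ∧ x i ≤ U i) → ∀ i, x i = U i → h x i ≤ 0)
    (x0 : Fin 4 → ℝ) (hx0 : ∀ i, 0 ≤ x0 i ∧ x0 i ≤ U i) :
    ∃ x : ℝ → Fin 4 → ℝ, IsSolOn h Orthant x ∧ x 0 = x0 := by
  set cl : (Fin 4 → ℝ) → (Fin 4 → ℝ) := fun x i => max 0 (min (U i) (x i)) with hcl
  have hbox : ∀ x i, 0 ≤ cl x i ∧ cl x i ≤ U i := fun x i =>
    ⟨le_max_left _ _, max_le (hU i) (min_le_left _ _)⟩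
  have hcomp : IsCompact (Icc (0 : Fin 4 → ℝ) U) := isCompact_Icc
  have hmem : ∀ x, cl x ∈ Icc (0 : Fin 4 → ℝ) U := fun x =>
    ⟨fun i => (hbox x i).1, fun i => (hbox x i).2⟩
  obtain ⟨C, hC⟩ := LocallyLipschitzOn.exists_lipschitzOnWith_of_compact hcomp
    (hl.locallyLipschitzOn (s := Icc (0 : Fin 4 → ℝ) U))
  have hcll : LipschitzWith 1 cl := by
    apply LipschitzWith.of_dist_le_mul
    intro x y
    rw [NNReal.coe_one, one_mul, dist_pi_le_iff dist_nonneg]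
    intro i
    refine le_trans ?_ (dist_le_pi_dist x y i)
    rw [Real.dist_eq, Real.dist_eq]
    have h1 := abs_max_sub_max_le_abs (min (U i) (x i)) (min (U i) (y i)) 0
    have h2 := abs_min_sub_min_le_max (U i) (x i) (U i) (y i)
    rw [sub_self, abs_zero, max_eq_right (abs_nonneg _)] at h2
    rw [max_comm _ 0, max_comm _ 0] at h1
    exact h1.trans h2
  have hg : LipschitzWith (C * 1) (h ∘ cl) := by
    rw [← lipschitzOnWith_univ]
    exact hC.comp hcll.lipschitzOnWith (fun x _ => hmem x)
  obtain ⟨B, hB⟩ := hcomp.exists_bound_of_continuousOn (f := h) hl.continuous.continuousOn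
  obtain ⟨x, hx1, hx2⟩ := global_exists (h ∘ cl) (C * 1) B.toNNReal hg
    (fun y => (hB _ (hmem y)).trans (Real.le_coe_toNNReal B)) x0
  have hd : ∀ i t, HasDerivAt (fun t => x t i) (h (cl (x t)) i) t := fun i t =>
    (hasDerivAt_pi.1 (hx2 t)) i
  have lo : ∀ i t, 0 ≤ t → 0 ≤ x t i := by
    intro i
    refine scalar_nonneg (fun t => x t i) _ (fun t _ => hd i t) ?_ ?_
    · simp only [hx1]; exact (hx0 i).1
    · intro t _ hn
      refine hlow _ (hbox _) i ?_
      simp only [hcl]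
      exact max_eq_left (le_trans (min_le_right _ _) hn.le)
  have up : ∀ i t, 0 ≤ t → 0 ≤ U i - x t i := by
    intro i
    refine scalar_nonneg (fun t => U i - x t i) _ (fun t _ => (hd i t).const_sub (U i)) ?_ ?_
    · simp only [hx1]; linarith [(hx0 i).2]
    · intro t _ hn
      rw [neg_nonneg]
      refine hup _ (hbox _) i ?_
      simp only [hcl]
      rw [min_eq_left (by linarith), max_eq_right (hU i)]
  refine ⟨x, ⟨fun t ht => ?_, fun t ht i => lo i t ht⟩, hx1⟩
  have : cl (x t) = x t := by
    funext i
    simp only [hcl]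
    rw [min_eq_right (by linarith [up i t ht]), max_eq_right (lo i t ht)]
  have h3 := hx2 t
  simp only [Function.comp, this] at h3
  exact h3

theorem model_exists (b K γ r νI μI νY μY δ μF μM : ℝ)
    (hb : 0 < b) (hK : 0 < K) (hγ : 0 < γ) (hr : 0 < r) (hr1 : r < 1)
    (hνI : 0 < νI) (hμI : 0 < μI) (hνY : 0 < νY) (hμY : 0 < μY)
    (hδ : 0 < δ) (hμF : 0 < μF) (hμM : 0 < μM) :
    ∃ U : Fin 4 → ℝ, (∀ i, 0 < U i) ∧ ∀ x0 : Fin 4 → ℝ, (∀ i, 0 ≤ x0 i ∧ x0 i ≤ U i) →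
      ∃ x, IsSolOn (redModel b K γ r νI μI νY μY δ μF μM) Orthant x ∧ x 0 = x0 := by
  have hr2 : 0 < 1 - r := by linarith
  obtain ⟨UM, hUM⟩ : ∃ UM, UM = (1 - r) * νI * K / μM := ⟨_, rfl⟩
  have pM : 0 < UM := by rw [hUM]; positivity
  obtain ⟨UF, hUF⟩ : ∃ UF, UF = νY * γ * UM / (δ + μF) := ⟨_, rfl⟩
  have pF : 0 < UF := by rw [hUF]; positivity
  obtain ⟨UY, hUY⟩ : ∃ UY, UY = (r * νI * K + δ * UF) / μY := ⟨_, rfl⟩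
  have pY : 0 < UY := by rw [hUY]; positivity
  have eM : UM * μM = (1 - r) * νI * K := by rw [hUM]; field_simp
  have eF : UF * (δ + μF) = νY * γ * UM := by rw [hUF]; field_simp
  have eY : UY * μY = r * νI * K + δ * UF := by rw [hUY]; field_simp
  clear hUM hUF hUY
  have pU : ∀ i, 0 < (![K, UY, UF, UM] : Fin 4 → ℝ) i := by
    intro i; fin_cases i <;> simp [hK, pY, pF, pM]
  refine ⟨![K, UY, UF, UM], pU, fun x0 hx0 => ?_⟩
  refine clamp_exists _ (red_lip _ _ _ _ _ _ _ _ _ _ _) _ (fun i => (pU i).le) ?_ ?_ x0 hx0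
  · intro x hx i hi
    have h0 := (hx 0).1
    have h1 := (hx 1).1
    have h2 := (hx 2).1
    have h3 := (hx 3).1
    have hm : 0 ≤ min (γ * x 3) (x 1) := le_min (by positivity) h1
    fin_cases i <;> simp [redModel] at hi ⊢ <;> rw [hi]
    · simp; positivity
    · rw [hi] at hm
      rw [min_eq_right (by positivity)]; simp; positivity
    · rw [mul_zero]; exact mul_nonneg hνY.le hm
    · rw [mul_zero]; positivity
  · intro x hx i hi
    have h0 := (hx 0).1
    have h1 := (hx 1).1
    have h2 := (hx 2).1
    have h3 := (hx 3).1
    have g0 := (hx 0).2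
    have g1 := (hx 1).2
    have g2 := (hx 2).2
    have g3 := (hx 3).2
    simp at g0 g1 g2 g3
    have hm : 0 ≤ min (γ * x 3) (x 1) := le_min (by positivity) h1
    have hm2 : min (γ * x 3) (x 1) ≤ γ * x 3 := min_le_left _ _
    fin_cases i <;> simp [redModel] at hi ⊢ 
    · rw [hi, div_self hK.ne']; simp; positivity
    · have k1 : r * νI * x 0 ≤ r * νI * K := by gcongr
      have k2 : δ * x 2 ≤ δ * UF := by gcongr
      have k3 := mul_nonneg hνY.le hm
      have k4 : μY * x 1 = UY * μY := by rw [hi]; ring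
      linarith
    · have k1 : νY * min (γ * x 3) (x 1) ≤ νY * (γ * UM) := by
        gcongr; exact hm2.trans (by gcongr)
      rw [hi]; linarith
    · have k1 : (1 - r) * νI * x 0 ≤ (1 - r) * νI * K := by gcongr
      rw [hi]; linarith

theorem unstable_core (b K γ r νI μI νY μY δ μF μM I Y F M : ℝ)
    (hb : 0 < b) (hK : 0 < K) (hγ : 0 < γ) (hr : 0 < r) (hr1 : r < 1)
    (hνI : 0 < νI) (hμI : 0 < μI) (hνY : 0 < νY) (hμY : 0 < μY)
    (hδ : 0 < δ) (hμF : 0 < μF) (hμM : 0 < μM)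
    (hI : 0 < I) (hY : 0 < Y) (hF : 0 < F) (hM : 0 < M)
    (E1 : b * (1 - I / K) * F = (νI + μI) * I)
    (E2 : r * νI * I + δ * F = (νY + μY) * Y)
    (E3 : νY * Y = (δ + μF) * F)
    (E4 : (1 - r) * νI * I = μM * M)
    (hYM : Y < γ * M) :
    ¬ StableOn (fullModel b K γ r νI μI νY μY δ μF μM) Orthant 0 := by
  have hr2 : 0 < 1 - r := by linarith
  -- the direction `a`
  obtain ⟨e, ⟨⟨⟨⟨e1, e2⟩, e3⟩, e4⟩, e5⟩, he⟩ := ((((((small (b * νY) (b * F * I / K) (by positivity)).and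
    (small (δ + μF / 2) Y hY)).and (small νY F hF)).and (small 1 M hM)).and
    (small (γ - (δ + μF / 2)) (γ * M - Y) (by linarith))).and
    (self_mem_nhdsWithin (a := (0:ℝ)) (s := Ioi 0))).exists
  replace he : 0 < e := he
  obtain ⟨a2, ha2⟩ : ∃ a2, a2 = Y - e * (δ + μF / 2) := ⟨_, rfl⟩
  obtain ⟨a3, ha3⟩ : ∃ a3, a3 = F - e * νY := ⟨_, rfl⟩
  obtain ⟨a4, ha4⟩ : ∃ a4, a4 = M - e := ⟨_, rfl⟩
  have p2 : 0 < a2 := by linarith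
  have p3 : 0 < a3 := by linarith
  have p4 : 0 < a4 := by linarith
  have A5 : a2 < γ * a4 := by rw [ha2, ha4]; linarith
  have A1 : 0 < b * a3 - (νI + μI) * I := by
    rw [ha3, ← E1]
    have : b * (F - e * νY) - b * (1 - I / K) * F = b * F * I / K - e * (b * νY) := by ring
    linarith
  have A2 : 0 < r * νI * I + δ * a3 - (νY + μY) * a2 := by
    have : r * νI * I + δ * a3 - (νY + μY) * a2 = e * (νY * (μF / 2) + μY * (δ + μF / 2)) := by
      rw [ha2, ha3]; linear_combination E2
    rw [this]; positivity
  have A3 : 0 < νY * a2 - (δ + μF) * a3 := by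
    have : νY * a2 - (δ + μF) * a3 = e * (νY * (μF / 2)) := by
      rw [ha2, ha3]; linear_combination E3
    rw [this]; positivity
  have A4 : 0 < (1 - r) * νI * I - μM * a4 := by
    have : (1 - r) * νI * I - μM * a4 = e * μM := by
      rw [ha4]; linear_combination E4
    rw [this]; positivity
  clear e1 e2 e3 e4 e5 ha2 ha3 ha4
  obtain ⟨η, ⟨⟨⟨B1, B2⟩, B3⟩, B4⟩, hη⟩ := (((((small (b * a3 / K + I) _ A1).and (small a2 _ A2)).and
    (small a3 _ A3)).and (small a4 _ A4)).and
    (self_mem_nhdsWithin (a := (0:ℝ)) (s := Ioi 0))).exists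
  replace hη : 0 < η := hη
  intro hst
  obtain ⟨d, hd, hst⟩ := hst η hη
  obtain ⟨U, hU, hex⟩ := model_exists b K γ r νI μI νY μY δ μF μM hb hK hγ hr hr1 hνI hμI hνY hμY
    hδ hμF hμM
  set a : Fin 4 → ℝ := ![I, a2, a3, a4] with ha
  have pa : ∀ i, 0 < a i := by
    intro i; fin_cases i <;> simp [ha, hI, p2, p3, p4]
  have evU : ∀ᶠ s in 𝓝[>] (0:ℝ), ∀ i, s * a i < min (U i) d := by
    rw [eventually_all]
    exact fun i => small _ _ (lt_min (hU i) hd)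
  obtain ⟨s0, hs0, ps0⟩ := (evU.and (self_mem_nhdsWithin (a := (0:ℝ)) (s := Ioi 0))).exists
  replace ps0 : 0 < s0 := ps0
  obtain ⟨x, hx, hx0⟩ := hex (fun i => s0 * a i) (fun i =>
    ⟨(mul_pos ps0 (pa i)).le, ((hs0 i).trans_le (min_le_left _ _)).le⟩)
  have hxf : IsSolOn (fullModel b K γ r νI μI νY μY δ μF μM) Orthant x :=
    ⟨fun t ht => by rw [full_eq_red _ _ _ _ _ _ _ _ _ _ _ hγ _ (hx.2 t ht)]; exact hx.1 t ht, hx.2⟩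
  have hsmall := hst x hxf (by
    rw [hx0, dist_pi_lt_iff hd]
    intro i
    rw [Pi.zero_apply, Real.dist_eq, sub_zero, abs_of_pos (mul_pos ps0 (pa i))]
    exact (hs0 i).trans_le (min_le_right _ _))
  have hI' : ∀ t, 0 ≤ t → x t 0 < η := by
    intro t ht
    have h1 := (dist_le_pi_dist (x t) 0 0).trans_lt (hsmall t ht)
    rw [Pi.zero_apply, Real.dist_eq, sub_zero] at h1
    exact (le_abs_self _).trans_lt h1
  have hdx : ∀ i t, 0 ≤ t → HasDerivAt (fun t => x t i)
      (redModel b K γ r νI μI νY μY δ μF μM (x t) i) t := fun i t ht =>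
    (hasDerivAt_pi.1 (hx.1 t ht)) i
  have main := trap_nonneg (fun (i : Fin 4) t => x t i - s0 * Real.exp (η * t) * a i)
    (fun i t => redModel b K γ r νI μI νY μY δ μF μM (x t) i - η * (s0 * Real.exp (η * t)) * a i)
    (by
      intro i t ht
      refine (hdx i t ht).sub ?_
      have h1 : HasDerivAt (fun t => Real.exp (η * t)) (Real.exp (η * t) * η) t := by
        simpa using ((hasDerivAt_id t).const_mul η).exp
      refine ((h1.const_mul s0).mul_const (a i)).congr_deriv ?_
      ring)
    (by intro i; simp [hx0])
    (by
      intro t ht hj i hi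
      have hs : 0 < s0 * Real.exp (η * t) := by positivity
      set s := s0 * Real.exp (η * t)
      have j0 := hj 0
      have j1 := hj 1
      have j2 := hj 2
      have j3 := hj 3
      have o := hx.2 t ht
      have o2 := o 2
      have l0 := hI' t ht
      simp [ha] at j0 j1 j2 j3
      have hm : s * a2 ≤ min (γ * x t 3) (x t 1) := by
        refine le_min ?_ j1
        have : γ * (s * a4) ≤ γ * x t 3 := by gcongr
        have : s * a2 ≤ s * (γ * a4) := by gcongr
        linarith
      have hm2 : min (γ * x t 3) (x t 1) ≤ x t 1 := min_le_right _ _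
      fin_cases i <;> simp [redModel, ha] at hi ⊢
      · have hi' : x t 0 = s * I := by linarith
        have B1' := mul_lt_mul_of_pos_left B1 hs
        have k1 : b * (1 - x t 0 / K) * x t 2 ≥ b * (1 - η / K) * (s * a3) := by
          have h1 : 0 < 1 - η / K := by
            by_contra hc
            push Not at hc
            have h3 : b * a3 * (1 - η / K) ≤ 0 :=
              mul_nonpos_of_nonneg_of_nonpos (by positivity) hc
            have h4 : 0 < (νI + μI) * I := by positivity
            have h5 : 0 < η * I := by positivity
            have h6 : η * (b * a3 / K + I) = b * a3 - b * a3 * (1 - η / K) + η * I := by ring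
            linarith
          have h2 : 1 - η / K ≤ 1 - x t 0 / K := by gcongr
          have h7 : 0 ≤ 1 - x t 0 / K := h1.le.trans h2
          have h8 : b * (1 - η / K) ≤ b * (1 - x t 0 / K) := by gcongr
          exact mul_le_mul h8 j2 (by positivity) (by positivity)
        rw [hi'] at k1 ⊢
        have h9 : b * (1 - η / K) * (s * a3) = s * (b * a3) - s * (η * (b * a3 / K)) := by ring
        linarith
      · have hi' : x t 1 = s * a2 := by linarith
        have B2' := mul_lt_mul_of_pos_left B2 hs
        have k1 : r * νI * (s * I) ≤ r * νI * x t 0 := by gcongr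
        have k2 : δ * (s * a3) ≤ δ * x t 2 := by gcongr
        have k3 : νY * min (γ * x t 3) (x t 1) ≤ νY * x t 1 := by gcongr
        rw [hi'] at k3 ⊢
        linarith
      · have hi' : x t 2 = s * a3 := by linarith
        have B3' := mul_lt_mul_of_pos_left B3 hs
        have k1 : νY * (s * a2) ≤ νY * min (γ * x t 3) (x t 1) := by gcongr
        rw [hi']
        linarith
      · have hi' : x t 3 = s * a4 := by linarith
        have B4' := mul_lt_mul_of_pos_left B4 hs
        have k1 : (1 - r) * νI * (s * I) ≤ (1 - r) * νI * x t 0 := by gcongr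
        rw [hi']
        linarith)
  have hT : 0 ≤ 1 / (s0 * I) := by positivity
  have m1 := main _ hT 0
  have m2 := hI' _ hT
  simp only [ha, Matrix.cons_val_zero] at m1
  have m3 := Real.add_one_le_exp (η * (1 / (s0 * I)))
  have m4 : s0 * (η * (1 / (s0 * I)) + 1) * I ≤ s0 * Real.exp (η * (1 / (s0 * I))) * I := by gcongr
  have m5 : s0 * (η * (1 / (s0 * I)) + 1) * I = η + s0 * I := by field_simp
  have m6 : 0 < s0 * I := by positivity
  linarith

set_option maxHeartbeats 2000000 in
theorem stable_core (b K γ r νI μI νY μY δ μF μM I Y F M : ℝ)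
    (hb : 0 < b) (hK : 0 < K) (hγ : 0 < γ) (hr : 0 < r) (hr1 : r < 1)
    (hνI : 0 < νI) (hμI : 0 < μI) (hνY : 0 < νY) (hμY : 0 < μY)
    (hδ : 0 < δ) (hμF : 0 < μF) (hμM : 0 < μM)
    (hI : 0 < I) (hY : 0 < Y) (hF : 0 < F) (hM : 0 < M) (hIK : I < K)
    (E1 : b * (1 - I / K) * F = (νI + μI) * I)
    (E2 : r * νI * I + δ * F = (νY + μY) * Y)
    (E3 : νY * Y = (δ + μF) * F)
    (E4 : (1 - r) * νI * I = μM * M)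
    (hYM : Y < γ * M) :
    ∃ w : Fin 4 → ℝ, ∃ η > 0, ∃ c0 > 0, (∀ i, 0 < w i) ∧ ∀ c, 0 < c → c ≤ c0 → ∀ x,
      IsSolOn (fullModel b K γ r νI μI νY μY δ μF μM) Orthant x →
      (∀ i, |x 0 i - (![I, Y, F, M] : Fin 4 → ℝ) i| ≤ c * w i) → ∀ t, 0 ≤ t →
      ∀ i, |x t i - (![I, Y, F, M] : Fin 4 → ℝ) i| ≤ c * Real.exp (-η * t) * w i := by
  have hr2 : 0 < 1 - r := by linarith
  have hIK' : 0 < 1 - I / K := by rw [sub_pos, div_lt_one hK]; exact hIK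
  obtain ⟨e, e1, he⟩ := ((small (b * (1 - I / K) * νY) (b * F * I / K) (by positivity)).and
    (self_mem_nhdsWithin (a := (0:ℝ)) (s := Ioi 0))).exists
  replace he : 0 < e := he
  obtain ⟨w2, hw2⟩ : ∃ w2, w2 = Y + e * (δ + μF / 2) := ⟨_, rfl⟩
  obtain ⟨w3, hw3⟩ : ∃ w3, w3 = F + e * νY := ⟨_, rfl⟩
  obtain ⟨w4, hw4⟩ : ∃ w4, w4 = M + e := ⟨_, rfl⟩
  have p2 : 0 < w2 := by rw [hw2]; positivity
  have p3 : 0 < w3 := by rw [hw3]; positivity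
  have p4 : 0 < w4 := by rw [hw4]; positivity
  have A1 : 0 < (b * F / K + νI + μI) * I - b * (1 - I / K) * w3 := by
    have : (b * F / K + νI + μI) * I - b * (1 - I / K) * w3
        = b * F * I / K - e * (b * (1 - I / K) * νY) := by
      rw [hw3]; linear_combination - E1
    linarith
  have A2 : 0 < (νY + μY) * w2 - (r * νI * I + δ * w3) := by
    have : (νY + μY) * w2 - (r * νI * I + δ * w3) = e * (νY * (μF / 2) + μY * (δ + μF / 2)) := by
      rw [hw2, hw3]; linear_combination - E2
    rw [this]; positivity
  have A3 : 0 < (δ + μF) * w3 - νY * w2 := by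
    have : (δ + μF) * w3 - νY * w2 = e * (νY * (μF / 2)) := by
      rw [hw2, hw3]; linear_combination - E3
    rw [this]; positivity
  have A4 : 0 < μM * w4 - (1 - r) * νI * I := by
    have : μM * w4 - (1 - r) * νI * I = e * μM := by
      rw [hw4]; linear_combination - E4
    rw [this]; positivity
  clear e1 hw2 hw3 hw4
  obtain ⟨η, ⟨⟨⟨⟨B1, B2⟩, B3⟩, B4⟩, B5⟩, hη⟩ := ((((((small (I + b * I * w3 / K) _ A1).and
    (small w2 _ A2)).and (small w3 _ A3)).and (small w4 _ A4)).and
    (small (w2 + γ * w4) (γ * M - Y) (by linarith))).and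
    (self_mem_nhdsWithin (a := (0:ℝ)) (s := Ioi 0))).exists
  replace hη : 0 < η := hη
  set w : Fin 4 → ℝ := ![I, w2, w3, w4] with hw
  refine ⟨w, η, hη, η, hη, ?_, ?_⟩
  · intro i; fin_cases i <;> simp [hw, hI, p2, p3, p4]
  intro c hc hcη x hx hx0
  set p : Fin 4 → ℝ := ![I, Y, F, M] with hp
  set f := redModel b K γ r νI μI νY μY δ μF μM with hf
  have hdx : ∀ i t, 0 ≤ t → HasDerivAt (fun t => x t i) (f (x t) i) t := by
    intro i t ht
    have := hx.1 t ht
    rw [full_eq_red _ _ _ _ _ _ _ _ _ _ _ hγ _ (hx.2 t ht)] at this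
    exact (hasDerivAt_pi.1 this) i
  have hde : ∀ i t, HasDerivAt (fun t => c * Real.exp (-η * t) * w i)
      (-η * (c * Real.exp (-η * t)) * w i) t := by
    intro i t
    have h1 : HasDerivAt (fun t => Real.exp (-η * t)) (Real.exp (-η * t) * -η) t := by
      simpa using ((hasDerivAt_id t).const_mul (-η)).exp
    refine ((h1.const_mul c).mul_const (w i)).congr_deriv ?_
    ring
  have main := trap_nonneg
    (fun (q : Fin 4 × Bool) t => c * Real.exp (-η * t) * w q.1 -
      (if q.2 then 1 else -1) * (x t q.1 - p q.1))
    (fun q t => -η * (c * Real.exp (-η * t)) * w q.1 - (if q.2 then 1 else -1) * f (x t) q.1)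
    (by
      intro q t ht
      exact (hde q.1 t).sub (((hdx q.1 t ht).sub_const _).const_mul _))
    (by
      rintro ⟨i, s⟩
      have := abs_le.1 (hx0 i)
      cases s <;> simp <;> linarith)
    (by
      rintro t ht hj ⟨i, σ⟩ hi
      have hs : 0 < c * Real.exp (-η * t) := by positivity
      have hs2 : c * Real.exp (-η * t) ≤ η := by
        have : Real.exp (-η * t) ≤ 1 := by
          rw [Real.exp_le_one_iff]; nlinarith
        calc c * Real.exp (-η * t) ≤ c * 1 := by gcongr
          _ ≤ η := by linarith
      have j0 := hj (0, true)
      have j1 := hj (1, true)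
      have j2 := hj (2, true)
      have j3 := hj (3, true)
      have i0 := hj (0, false)
      have i1 := hj (1, false)
      have i2 := hj (2, false)
      have i3 := hj (3, false)
      clear hj
      simp only [neg_mul, hw, hp] at *
      set s := c * Real.exp (-(η * t))
      simp at j0 j1 j2 j3 i0 i1 i2 i3
      have hm : min (γ * x t 3) (x t 1) = x t 1 := by
        apply min_eq_right
        have h1 : s * (w2 + γ * w4) ≤ η * (w2 + γ * w4) := by gcongr
        have h2 : γ * (M - s * w4) ≤ γ * x t 3 := by gcongr; linarith
        linarith
      have B2' := mul_lt_mul_of_pos_left B2 hs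
      have B3' := mul_lt_mul_of_pos_left B3 hs
      have B4' := mul_lt_mul_of_pos_left B4 hs
      have c1 : r * νI * (x t 0) ≤ r * νI * (I + s * I) := by gcongr; linarith
      have c1' : r * νI * (I - s * I) ≤ r * νI * (x t 0) := by gcongr; linarith
      have c2 : δ * (x t 2) ≤ δ * (F + s * w3) := by gcongr; linarith
      have c2' : δ * (F - s * w3) ≤ δ * (x t 2) := by gcongr; linarith
      have c3 : νY * (x t 1) ≤ νY * (Y + s * w2) := by gcongr; linarith
      have c3' : νY * (Y - s * w2) ≤ νY * (x t 1) := by gcongr; linarith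
      have c4 : (1 - r) * νI * (x t 0) ≤ (1 - r) * νI * (I + s * I) := by gcongr; linarith
      have c4' : (1 - r) * νI * (I - s * I) ≤ (1 - r) * νI * (x t 0) := by gcongr; linarith
      have B1a : s * (s * (b * I * w3 / K)) ≤ s * (η * (b * I * w3 / K)) := by gcongr
      have B1' := mul_lt_mul_of_pos_left B1 hs
      fin_cases i <;> cases σ <;> simp [redModel, hf, hm] at hi ⊢
      · have hi' : x t 0 = I - s * I := by linarith
        rw [hi']
        have h1 : 0 ≤ 1 - (I - s * I) / K := by
          have : 1 - (I - s * I) / K = (1 - I / K) + s * I / K := by ring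
          rw [this]; positivity
        have h2 : b * (1 - (I - s * I) / K) * (F - s * w3) ≤ b * (1 - (I - s * I) / K) * x t 2 := by
          gcongr; linarith
        have h3 : b * (1 - (I - s * I) / K) * (F - s * w3) = b * (1 - I / K) * F
          + s * (b * F / K * I) - s * (b * (1 - I / K) * w3) - s * (s * (b * I * w3 / K)) := by ring
        linarith
      · have hi' : x t 0 = I + s * I := by linarith
        rw [hi']
        rcases le_total 0 (1 - (I + s * I) / K) with h1 | h1
        · have h2 : b * (1 - (I + s * I) / K) * x t 2 ≤ b * (1 - (I + s * I) / K) * (F + s * w3) := by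
            gcongr; linarith
          have h3 : b * (1 - (I + s * I) / K) * (F + s * w3) = b * (1 - I / K) * F
            - s * (b * F / K * I) + s * (b * (1 - I / K) * w3) - s * (s * (b * I * w3 / K)) := by ring
          have h4 : 0 ≤ s * (s * (b * I * w3 / K)) := by positivity
          linarith
        · have h2 : b * (1 - (I + s * I) / K) * x t 2 ≤ b * (1 - (I + s * I) / K) * (F - s * w3) := by
            apply mul_le_mul_of_nonpos_left (by linarith)
            exact mul_nonpos_of_nonneg_of_nonpos hb.le h1
          have h3 : b * (1 - (I + s * I) / K) * (F - s * w3) = b * (1 - I / K) * F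
            - s * (b * F / K * I) - s * (b * (1 - I / K) * w3) + s * (s * (b * I * w3 / K)) := by ring
          have h4 : 0 ≤ s * (b * (1 - I / K) * w3) := by positivity
          linarith
      · have hi' : x t 1 = Y - s * w2 := by linarith
        rw [hi']
        linarith
      · have hi' : x t 1 = Y + s * w2 := by linarith
        rw [hi']
        linarith
      · have hi' : x t 2 = F - s * w3 := by linarith
        rw [hi']
        linarith
      · have hi' : x t 2 = F + s * w3 := by linarith
        rw [hi']
        linarith
      · have hi' : x t 3 = M - s * w4 := by linarith
        rw [hi']
        linarith
      · have hi' : x t 3 = M + s * w4 := by linarith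
        rw [hi']
        linarith)
  intro t ht i
  have m1 := main t ht (i, true)
  have m2 := main t ht (i, false)
  simp only [if_true, Bool.false_eq_true, if_false] at m1 m2
  rw [abs_le]
  constructor <;> linarith
/-- Under `N₀ > 1` and `Y* < γM*`, the uncontrolled model has exactly two equilibria in
ℝ⁴₊: `TE = (0,0,0,0)`, which is unstable, and `EE* = (I*, Y*, F*, M*)`, which is
asymptotically stable. -/
theorem uncontrolledModel_two_equilibria
    (b K γ r νI μI νY μY δ μF μM N0 Istar Ystar Fstar Mstar : ℝ)
    (hb : 0 < b) (hK : 0 < K) (hγ : 0 < γ) (hr : 0 < r) (hr1 : r < 1)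
    (hνI : 0 < νI) (hμI : 0 < μI) (hνY : 0 < νY) (hμY : 0 < μY)
    (hδ : 0 < δ) (hμF : 0 < μF) (hμM : 0 < μM)
    (hN0 : N0 = b * r * νI * νY / ((μI + νI) * ((νY + μY) * (δ + μF) - δ * νY)))
    (hgt : 1 < N0)
    (hIs : Istar = (1 - 1 / N0) * K)
    (hYs : Ystar = r * νI * (δ + μF) * Istar / ((νY + μY) * (δ + μF) - δ * νY))
    (hFs : Fstar = r * νI * νY * Istar / ((νY + μY) * (δ + μF) - δ * νY))
    (hMs : Mstar = (1 - r) * νI * Istar / μM)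
    (habund : Ystar < γ * Mstar) :
    (∀ x ∈ Orthant, fullModel b K γ r νI μI νY μY δ μF μM x = 0 ↔
      (x = 0 ∨ x = ![Istar, Ystar, Fstar, Mstar])) ∧
    ¬ StableOn (fullModel b K γ r νI μI νY μY δ μF μM) Orthant 0 ∧
    AsympStableOn (fullModel b K γ r νI μI νY μY δ μF μM) Orthant
      ![Istar, Ystar, Fstar, Mstar] := by
  have hr2 : 0 < 1 - r := by linarith
  obtain ⟨D, hD⟩ : ∃ D, D = (νY + μY) * (δ + μF) - δ * νY := ⟨_, rfl⟩
  have pD : 0 < D := by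
    have : D = νY * μF + μY * (δ + μF) := by rw [hD]; ring
    rw [this]; positivity
  rw [← hD] at hN0 hYs hFs
  have hN : 0 < N0 := by linarith
  have hNinv : 1 / N0 < 1 := by rw [div_lt_one hN]; exact hgt
  have pinv : 0 < 1 / N0 := by positivity
  have pI : 0 < Istar := by rw [hIs]; exact mul_pos (by linarith) hK
  have hIK : Istar < K := by rw [hIs]; nlinarith
  have pY : 0 < Ystar := by rw [hYs]; positivity
  have pF : 0 < Fstar := by rw [hFs]; positivity
  have pM : 0 < Mstar := by rw [hMs]; positivity
  have hfrac : 1 - Istar / K = 1 / N0 := by rw [hIs]; field_simp; ring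
  have hNe : b * r * νI * νY = N0 * ((μI + νI) * D) := by rw [hN0]; field_simp
  have EY : Ystar * D = r * νI * (δ + μF) * Istar := by rw [hYs]; field_simp
  have EF : Fstar * D = r * νI * νY * Istar := by rw [hFs]; field_simp
  have E1 : b * (1 - Istar / K) * Fstar = (νI + μI) * Istar := by
    rw [hfrac]
    have : b * (1 / N0) * Fstar * (N0 * D) = (νI + μI) * Istar * (N0 * D) := by
      have h1 : b * (1 / N0) * Fstar * (N0 * D) = b * (Fstar * D) := by field_simp
      rw [h1, EF]; linear_combination Istar * hNe
    exact mul_right_cancel₀ (by positivity) this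
  have E2 : r * νI * Istar + δ * Fstar = (νY + μY) * Ystar := by
    have : (r * νI * Istar + δ * Fstar) * D = (νY + μY) * Ystar * D := by
      linear_combination δ * EF - (νY + μY) * EY + r * νI * Istar * hD
    exact mul_right_cancel₀ pD.ne' this
  have E3 : νY * Ystar = (δ + μF) * Fstar := by
    have : νY * Ystar * D = (δ + μF) * Fstar * D := by
      linear_combination νY * EY - (δ + μF) * EF
    exact mul_right_cancel₀ pD.ne' this
  have E4 : (1 - r) * νI * Istar = μM * Mstar := by rw [hMs]; field_simp
  have hpO : (![Istar, Ystar, Fstar, Mstar] : Fin 4 → ℝ) ∈ Orthant := by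
    intro i; fin_cases i <;> simp [pI.le, pY.le, pF.le, pM.le]
  have hp0 : fullModel b K γ r νI μI νY μY δ μF μM ![Istar, Ystar, Fstar, Mstar] = 0 := by
    rw [full_eq_red _ _ _ _ _ _ _ _ _ _ _ hγ _ hpO]
    funext i
    fin_cases i <;> simp [redModel, min_eq_right habund.le] <;> linarith
  refine ⟨?_, ?_, hp0, ?_⟩
  · intro x hx
    constructor
    · intro h
      rw [full_eq_red _ _ _ _ _ _ _ _ _ _ _ hγ _ hx] at h
      have q0 := congrFun h 0
      have q1 := congrFun h 1
      have q2 := congrFun h 2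
      have q3 := congrFun h 3
      have o0 := hx 0
      have o1 := hx 1
      have o2 := hx 2
      have o3 := hx 3
      simp [redModel] at q0 q1 q2 q3
      have ext : ∀ A B C E : ℝ, x 0 = A → x 1 = B → x 2 = C → x 3 = E → x = ![A, B, C, E] := by
        intro A B C E h0 h1 h2 h3
        funext i
        fin_cases i <;> simp [h0, h1, h2, h3]
      have hz : (![0, 0, 0, 0] : Fin 4 → ℝ) = 0 := by
        funext i; fin_cases i <;> rfl
      by_cases hI0 : x 0 = 0
      · left
        have x3 : x 3 = 0 := by
          rw [hI0] at q3
          have : μM * x 3 = 0 := by linarith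
          exact (mul_eq_zero.1 this).resolve_left hμM.ne'
        rw [x3, mul_zero, min_eq_left o1] at q1 q2
        have x2 : x 2 = 0 := by
          have : (δ + μF) * x 2 = 0 := by linarith
          exact (mul_eq_zero.1 this).resolve_left (by positivity)
        have x1 : x 1 = 0 := by
          rw [hI0, x2] at q1
          have : μY * x 1 = 0 := by linarith
          exact (mul_eq_zero.1 this).resolve_left hμY.ne'
        rw [← hz]; exact ext _ _ _ _ hI0 x1 x2 x3
      · right
        have hIp : 0 < x 0 := lt_of_le_of_ne o0 (Ne.symm hI0)
        rcases le_or_gt (x 1) (γ * x 3) with hc | hc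
        · rw [min_eq_right hc] at q1 q2
          have f1 : x 2 * D = r * νI * νY * x 0 := by
            linear_combination x 2 * hD - νY * q1 - (νY + μY) * q2
          have f0 : 1 - x 0 / K = 1 / N0 := by
            have : (1 - x 0 / K) * (N0 * ((μI + νI) * D) * x 0)
                = 1 / N0 * (N0 * ((μI + νI) * D) * x 0) := by
              have h1 : 1 / N0 * (N0 * ((μI + νI) * D) * x 0) = (μI + νI) * D * x 0 := by field_simp
              rw [h1, ← hNe]
              linear_combination - b * (1 - x 0 / K) * f1 + D * q0
            exact mul_right_cancel₀ (by positivity) this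
          have x0 : x 0 = Istar := by
            rw [← hfrac] at f0
            have : x 0 / K = Istar / K := by linarith
            field_simp at this
            exact this
          have x2 : x 2 = Fstar := by
            rw [x0] at f1
            exact mul_right_cancel₀ pD.ne' (f1.trans EF.symm)
          have x1 : x 1 = Ystar := by
            have : νY * x 1 = νY * Ystar := by rw [E3, ← x2]; linarith
            exact mul_left_cancel₀ hνY.ne' this
          have x3 : x 3 = Mstar := by
            have : μM * x 3 = μM * Mstar := by rw [← E4, ← x0]; linarith
            exact mul_left_cancel₀ hμM.ne' this
          exact ext _ _ _ _ x0 x1 x2 x3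
        · exfalso
          rw [min_eq_left hc.le] at q1 q2
          -- proportionality
          have g3 : x 3 * Istar = Mstar * x 0 := by
            have : μM * (x 3 * Istar) = μM * (Mstar * x 0) := by
              linear_combination - Istar * q3 + x 0 * E4
            exact mul_left_cancel₀ hμM.ne' this
          have h1 : γ * x 3 * D < r * νI * (δ + μF) * x 0 := by
            have e1 : μY * (δ + μF) * x 1 = r * νI * (δ + μF) * x 0 - νY * μF * (γ * x 3) := by
              linear_combination - (δ + μF) * q1 - δ * q2
            have e2 : μY * (δ + μF) * (γ * x 3) < μY * (δ + μF) * x 1 := by gcongr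
            have e3 : γ * x 3 * D = νY * μF * (γ * x 3) + μY * (δ + μF) * (γ * x 3) := by
              rw [hD]; ring
            linarith
          have h2 : γ * x 3 * D * Istar < r * νI * (δ + μF) * x 0 * Istar := by gcongr
          have h3 : Ystar * (D * x 0) < γ * Mstar * (D * x 0) := by gcongr
          have h4 : γ * x 3 * D * Istar = γ * Mstar * (D * x 0) := by
            linear_combination γ * D * g3
          have h5 : r * νI * (δ + μF) * x 0 * Istar = Ystar * (D * x 0) := by
            linear_combination - x 0 * EY
          linarith
    · rintro (rfl | rfl)
      · funext i
        fin_cases i <;> simp [fullModel]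
      · exact hp0
  · exact unstable_core b K γ r νI μI νY μY δ μF μM Istar Ystar Fstar Mstar hb hK hγ hr hr1 hνI hμI
      hνY hμY hδ hμF hμM pI pY pF pM E1 E2 E3 E4 habund
  · obtain ⟨w, η, hη, c0, hc0, pw, H⟩ := stable_core b K γ r νI μI νY μY δ μF μM Istar Ystar Fstar
      Mstar hb hK hγ hr hr1 hνI hμI hνY hμY hδ hμF hμM pI pY pF pM hIK E1 E2 E3 E4 habund
    set p : Fin 4 → ℝ := ![Istar, Ystar, Fstar, Mstar] with hp
    have start : ∀ c, 0 < c → ∃ d > 0, ∀ y : Fin 4 → ℝ, dist y p < d → ∀ i, |y i - p i| ≤ c * w i := by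
      intro c hc
      have ev : ∀ᶠ d in 𝓝[>] (0:ℝ), ∀ i, d * 1 < c * w i := by
        rw [eventually_all]
        exact fun i => small _ _ (mul_pos hc (pw i))
      obtain ⟨d, h1, h2⟩ := (ev.and (self_mem_nhdsWithin (a := (0:ℝ)) (s := Ioi 0))).exists
      refine ⟨d, h2, fun y hy i => ?_⟩
      rw [← Real.dist_eq]
      have := dist_le_pi_dist y p i
      linarith [h1 i]
    constructor
    · intro ε hε
      have ev : ∀ᶠ c in 𝓝[>] (0:ℝ), ∀ i, c * w i < ε := by
        rw [eventually_all]
        exact fun i => small _ _ hε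
      obtain ⟨c, ⟨h1, h2⟩, h3⟩ := ((ev.and (small 1 c0 hc0)).and
        (self_mem_nhdsWithin (a := (0:ℝ)) (s := Ioi 0))).exists
      replace h3 : 0 < c := h3
      obtain ⟨d, hd, hs⟩ := start c h3
      refine ⟨d, hd, fun x hx hx0 t ht => ?_⟩
      rw [dist_pi_lt_iff hε]
      intro i
      rw [Real.dist_eq]
      refine (H c h3 (by linarith) x hx (hs _ hx0) t ht i).trans_lt ?_
      have h4 : Real.exp (-η * t) ≤ 1 := by
        rw [Real.exp_le_one_iff]; nlinarith
      have h5 := (pw i).le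
      calc c * Real.exp (-η * t) * w i ≤ c * 1 * w i := by gcongr
        _ < ε := by rw [mul_one]; exact h1 i
    · obtain ⟨d, hd, hs⟩ := start c0 hc0
      refine ⟨d, hd, fun x hx hx0 => ?_⟩
      rw [tendsto_pi_nhds]
      intro i
      rw [tendsto_iff_dist_tendsto_zero]
      have lim : Tendsto (fun t : ℝ => c0 * Real.exp (-η * t) * w i) atTop (𝓝 0) := by
        have h1 : Tendsto (fun t : ℝ => -η * t) atTop atBot :=
          tendsto_id.const_mul_atTop_of_neg (by linarith)
        have h2 := ((Real.tendsto_exp_atBot.comp h1).const_mul c0).mul_const (w i)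
        simpa using h2
      refine squeeze_zero' (Eventually.of_forall fun t => dist_nonneg) ?_ lim
      filter_upwards [eventually_ge_atTop (0:ℝ)] with t ht
      rw [Real.dist_eq]
      exact H c0 hc0 le_rfl x hx (hs _ hx0) t ht i
end
end

section
/- The equilibrium EE^# = (I*, Y*, F*, M^#(Y_P)) of the controlled male-abundance system lies in the male-abundance region, i.e. Y* + Y_P < γM^#(Y_P), if and only if Y_P < Y_P*, where Y_P* := (γM* - Y*)/(1 + α/μ_M) = [γ(1-r)ν_I - rν_I(δ+μ_F)μ_M/((ν_Y+μ_Y)(δ+μ_F) - δν_Y)] (1 - 1/N₀) K / (μ_M + α). -/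
noncomputable section

/-- The equilibrium `EE^# = (I*, Y*, F*, M^#(Y_P))` of the controlled male-abundance
system lies in the male-abundance region, i.e. `Y* + Y_P < γM^#(Y_P)`, if and only if
`Y_P < Y_P*`, where `Y_P* = (γM* - Y*)/(1 + α/μ_M)`, which equals the explicit
expression in the parameters. -/
theorem maleAbundanceRegion_iff_YP_lt_YPstar
    (b K γ r νI μI νY μY δ μF μM α YP N0 Istar Ystar Mstar Msharp YPstar : ℝ)
    (hb : 0 < b) (hK : 0 < K) (hγ : 0 < γ) (hr : 0 < r) (hr1 : r < 1)
    (hνI : 0 < νI) (hμI : 0 < μI) (hνY : 0 < νY) (hμY : 0 < μY)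
    (hδ : 0 < δ) (hμF : 0 < μF) (hμM : 0 < μM) (hα : 0 ≤ α) (hYP : 0 < YP)
    (hN0 : N0 = b * r * νI * νY / ((μI + νI) * ((νY + μY) * (δ + μF) - δ * νY)))
    (hgt : 1 < N0)
    (hIs : Istar = (1 - 1 / N0) * K)
    (hYs : Ystar = r * νI * (δ + μF) * Istar / ((νY + μY) * (δ + μF) - δ * νY))
    (hMs : Mstar = (1 - r) * νI * Istar / μM)
    (habund : Ystar < γ * Mstar)
    (hMsharp : Msharp = Mstar / (1 + α * YP / (μM * (Ystar + YP))))
    (hYPstar : YPstar = (γ * Mstar - Ystar) / (1 + α / μM)) :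
    (Ystar + YP < γ * Msharp ↔ YP < YPstar) ∧
    YPstar = (1 / (μM + α)) *
      (γ * (1 - r) * νI - r * νI * (δ + μF) * μM / ((νY + μY) * (δ + μF) - δ * νY)) *
      (1 - 1 / N0) * K := by
  have hD : 0 < (νY + μY) * (δ + μF) - δ * νY := by
    have : (νY + μY) * (δ + μF) - δ * νY = νY * μF + μY * (δ + μF) := by ring
    rw [this]; positivity
  have hI : 0 < Istar := by
    rw [hIs]
    have : 1 / N0 < 1 := by
      rw [div_lt_one (by linarith)]; exact hgt
    exact mul_pos (by linarith) hK
  have hY : 0 < Ystar := by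
    rw [hYs]; positivity
  have hS : 0 < Ystar + YP := by positivity
  constructor
  · have h1 : 0 < 1 + α * YP / (μM * (Ystar + YP)) := by positivity
    have h2 : 0 < 1 + α / μM := by positivity
    have h3 : (Ystar + YP) * (1 + α * YP / (μM * (Ystar + YP)))
        = Ystar + YP * (1 + α / μM) := by
      field_simp
      ring
    rw [hMsharp, hYPstar, ← mul_div_assoc, lt_div_iff₀ h1, lt_div_iff₀ h2, h3]
    constructor <;> intro h <;> linarith
  · rw [mul_assoc _ (1 - 1 / N0) K, ← hIs, hYPstar, hYs, hMs]
    have h4 : 0 < μM + α := by positivity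
    generalize (νY + μY) * (δ + μF) - δ * νY = D at hD
    have h2 : 1 + α / μM = (μM + α) / μM := by field_simp
    rw [h2]
    field_simp
end
end

section
/- A point (I,Y,F,M) with I > 0 is a non-trivial equilibrium of the controlled male-scarcity system if and only if Y = (rν_I/μ_Y - μ_F(ν_I+μ_I)/(μ_Y b(1 - I/K)))I, F = (ν_I+μ_I)I/(b(1 - I/K)), M = (1-r)ν_I I/(μ_M + αY_P/(Y+Y_P)), and I satisfies the cubic equation ψ(I) = η(Y_P, I), where ψ(I) = I·ξ(I)·φ(I) with ξ(I) = ν_Yγ(1-r)ν_I b(1 - I/K) - (δ+μ_F)(ν_I+μ_I)μ_M, φ(I) = rν_I b(1 - I/K) - μ_F(ν_I+μ_I), and η(Y_P, I) = μ_Y(δ+μ_F)(ν_I+μ_I)(μ_M+α) b(1 - I/K) Y_P. -/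
noncomputable section

/-- A point `(I, Y, F, M)` with `I > 0` is a non-trivial equilibrium of the controlled
male-scarcity system if and only if `Y`, `F`, `M` are given by the stated expressions in
`I` and `I` satisfies the cubic equation `ψ(I) = η(Y_P, I)`. -/
theorem controlledScarcity_nontrivial_equilibria_iff
    (b K γ r νI μI νY μY δ μF μM α YP : ℝ)
    (hb : 0 < b) (hK : 0 < K) (hγ : 0 < γ) (hr : 0 < r) (hr1 : r < 1)
    (hνI : 0 < νI) (hμI : 0 < μI) (hνY : 0 < νY) (hμY : 0 < μY)
    (hδ : 0 < δ) (hμF : 0 < μF) (hμM : 0 < μM) (hα : 0 ≤ α) (hYP : 0 < YP) :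
    ∀ I Y F M : ℝ, 0 < I →
      ((b * (1 - I / K) * F - (νI + μI) * I = 0 ∧
        r * νI * I - νY * γ * M * Y / (Y + YP) + δ * F - μY * Y = 0 ∧
        νY * γ * M * Y / (Y + YP) - (δ + μF) * F = 0 ∧
        (1 - r) * νI * I - (μM + α * YP / (Y + YP)) * M = 0)
      ↔
       (Y = (r * νI / μY - μF * (νI + μI) / (μY * b * (1 - I / K))) * I ∧
        F = (νI + μI) * I / (b * (1 - I / K)) ∧
        M = (1 - r) * νI * I / (μM + α * YP / (Y + YP)) ∧
        I * (νY * γ * (1 - r) * νI * b * (1 - I / K) - (δ + μF) * (νI + μI) * μM) *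
          (r * νI * b * (1 - I / K) - μF * (νI + μI)) =
          μY * (δ + μF) * (νI + μI) * (μM + α) * b * (1 - I / K) * YP)) := by
  intro I Y F M hI
  generalize 1 - I / K = w
  have hN : 0 < νI + μI := by positivity
  generalize νI + μI = N at *
  have hG : 0 < δ + μF := by positivity
  have hr2 : 0 < 1 - r := by linarith
  have hA : 0 < νY * γ * (1 - r) * νI := by positivity
  by_cases hw : w = 0
  · subst hw
    constructor
    · rintro ⟨h1, -⟩
      have : 0 < N * I := by positivity
      linarith
    · rintro ⟨-, -, -, h4⟩
      have : 0 < I * ((δ + μF) * N * μM) * (μF * N) := by positivity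
      exfalso
      linarith
  -- formula for `Y` in polynomial form
  have hYiff : Y = (r * νI / μY - μF * N / (μY * b * w)) * I ↔
      μY * b * w * Y = I * (r * νI * b * w - μF * N) := by
    constructor
    · intro h
      rw [h]; field_simp
    · intro h
      have h0 : μY * b * w ≠ 0 := by positivity
      apply mul_left_cancel₀ h0
      rw [h]; field_simp
  have hFiff : F = N * I / (b * w) ↔ b * w * F = N * I := by
    rw [eq_div_iff (by positivity)]
    constructor <;> intro h <;> linarith
  rw [hYiff, hFiff]
  have hc0 : μY * b * w ≠ 0 := by positivity
  -- the cubic, given the formula for `Y`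
  have hcub : μY * b * w * Y = I * (r * νI * b * w - μF * N) →
      (I * (νY * γ * (1 - r) * νI * b * w - (δ + μF) * N * μM) *
          (r * νI * b * w - μF * N) =
          μY * (δ + μF) * N * (μM + α) * b * w * YP ↔
        νY * γ * (1 - r) * νI * (b * w) * Y
          = (δ + μF) * N * (μM * (Y + YP) + α * YP)) := by
    intro h
    constructor
    · intro h4
      apply mul_left_cancel₀ hc0
      linear_combination h4 + (νY * γ * (1 - r) * νI * b * w - (δ + μF) * N * μM) * h
    · intro h4
      linear_combination (μY * b * w) * h4
        - (νY * γ * (1 - r) * νI * b * w - (δ + μF) * N * μM) * h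
  by_cases hS : Y + YP = 0
  · constructor
    · rintro ⟨h1, h2, h3, h4⟩
      exfalso
      rw [hS] at h3
      simp only [div_zero, zero_sub, neg_eq_zero] at h3
      have hF : F = 0 := (mul_eq_zero.mp h3).resolve_left hG.ne'
      rw [hF] at h1
      have : 0 < N * I := by positivity
      linarith
    · rintro ⟨h1, h2, h3, h4⟩
      exfalso
      rw [hcub h1, hS] at h4
      have hY : Y = -YP := by linarith
      rw [hY] at h4 h1
      have e : νY * γ * (1 - r) * νI * (b * w) = - ((δ + μF) * N * α) := by
        apply mul_right_cancel₀ hYP.ne'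
        linear_combination -h4
      have e2 : 0 ≤ (δ + μF) * N * α := by positivity
      have hu : b * w ≤ 0 := by
        by_contra hcon
        have : 0 < νY * γ * (1 - r) * νI * (b * w) := mul_pos hA (not_le.mp hcon)
        linarith
      have p1 : 0 ≤ (μY * YP) * (-(b * w)) := mul_nonneg (by positivity) (by linarith)
      have p2 : 0 ≤ (I * r * νI) * (-(b * w)) := mul_nonneg (by positivity) (by linarith)
      have p3 : 0 < I * (μF * N) := by positivity
      nlinarith
  by_cases hD : μM * (Y + YP) + α * YP = 0
  · have hD' : μM + α * YP / (Y + YP) = 0 := by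
      field_simp; linarith
    constructor
    · rintro ⟨h1, h2, h3, h4⟩
      rw [hD'] at h4
      have : 0 < (1 - r) * νI * I := by positivity
      linarith
    · rintro ⟨h1, h2, h3, h4⟩
      exfalso
      rw [hcub h1, hD, mul_zero] at h4
      have hY : Y = 0 :=
        (mul_eq_zero.mp h4).resolve_left (mul_ne_zero hA.ne' (mul_ne_zero hb.ne' hw))
      rw [hY] at hD
      have : 0 < μM * YP := by positivity
      have : 0 ≤ α * YP := by positivity
      linarith
  have hDe : μM + α * YP / (Y + YP) = (μM * (Y + YP) + α * YP) / (Y + YP) := by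
    field_simp
  have hMiff : M = (1 - r) * νI * I / (μM + α * YP / (Y + YP)) ↔
      (μM * (Y + YP) + α * YP) * M = (1 - r) * νI * I * (Y + YP) := by
    rw [hDe, div_div_eq_mul_div, eq_div_iff hD, mul_comm M]
  have h4iff : (1 - r) * νI * I - (μM + α * YP / (Y + YP)) * M = 0 ↔
      (μM * (Y + YP) + α * YP) * M = (1 - r) * νI * I * (Y + YP) := by
    rw [hDe, div_mul_eq_mul_div, sub_eq_zero, eq_div_iff hS, eq_comm]
  have h3iff : νY * γ * M * Y / (Y + YP) - (δ + μF) * F = 0 ↔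
      νY * γ * M * Y = (δ + μF) * F * (Y + YP) := by
    rw [sub_eq_zero, div_eq_iff hS]
  rw [hMiff, h4iff]
  constructor
  · rintro ⟨h1, h2, h3, h4⟩
    have hy : μY * b * w * Y = I * (r * νI * b * w - μF * N) := by
      linear_combination (-b * w) * h2 - (b * w) * h3 - μF * h1
    refine ⟨hy, by linarith, h4, ?_⟩
    rw [hcub hy]
    rw [h3iff] at h3
    have hIS : I * (Y + YP) ≠ 0 := mul_ne_zero hI.ne' hS
    apply mul_left_cancel₀ hIS
    linear_combination (-νY * γ * b * w * Y) * h4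
      + (b * w * (μM * (Y + YP) + α * YP)) * h3
      + ((δ + μF) * (Y + YP) * (μM * (Y + YP) + α * YP)) * h1
  · rintro ⟨hy, h1, h4, h5⟩
    rw [hcub hy] at h5
    have h3 : νY * γ * M * Y / (Y + YP) - (δ + μF) * F = 0 := by
      rw [h3iff]
      have hx : b * w * (μM * (Y + YP) + α * YP) ≠ 0 :=
        mul_ne_zero (mul_ne_zero hb.ne' hw) hD
      apply mul_left_cancel₀ hx
      linear_combination (I * (Y + YP)) * h5 + (νY * γ * b * w * Y) * h4
        - ((δ + μF) * (Y + YP) * (μM * (Y + YP) + α * YP)) * h1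
    refine ⟨by linarith, ?_, h3, h4⟩
    apply mul_left_cancel₀ (mul_ne_zero hb.ne' hw)
    linear_combination (-b * w) * h3 - hy - μF * h1
end
end

section
/- Assume N₀ > 1 and Y* < γM*. There exists a threshold Y_P** > 0 such that: (i) if Y_P > Y_P** the equation ψ(I) = η(Y_P, I) has no root in the interval (0, min{I₁, I₂}), hence TE is the only equilibrium of the controlled male-scarcity system in ℝ⁴₊; (ii) if 0 < Y_P < Y_P** the equation ψ(I) = η(Y_P, I) has exactly two roots in (0, min{I₁, I₂}), giving TE and two positive equilibria of the system. -/
open Set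

noncomputable section

/-- The vector field of the controlled male-scarcity system with lure strength `YP`. -/
def cScarce (b K γ r νI μI νY μY δ μF μM α YP : ℝ) : (Fin 4 → ℝ) → (Fin 4 → ℝ) := fun x =>
  ![b * (1 - x 0 / K) * x 2 - (νI + μI) * x 0,
    r * νI * x 0 - νY * γ * x 3 * x 1 / (x 1 + YP) + δ * x 2 - μY * x 1,
    νY * γ * x 3 * x 1 / (x 1 + YP) - (δ + μF) * x 2,
    (1 - r) * νI * x 0 - (μM + α * YP / (x 1 + YP)) * x 3]

theorem cubic_pos_aux (a b c d u v w x : ℝ) (ha : 0 < a) (huv : u ≠ v) (huw : u ≠ w) (hvw : v ≠ w)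
    (hu : a*u^3+b*u^2+c*u+d = 0) (hv : a*v^3+b*v^2+c*v+d = 0) (hw : a*w^3+b*w^2+c*w+d = 0)
    (xu : u < x) (xv : v < x) (xw : w < x) : 0 < a*x^3+b*x^2+c*x+d := by
  have h1 : a*(u^2+u*v+v^2)+b*(u+v)+c = 0 := by
    apply mul_left_cancel₀ (sub_ne_zero.2 huv); linear_combination hu - hv
  have h2 : a*(u^2+u*w+w^2)+b*(u+w)+c = 0 := by
    apply mul_left_cancel₀ (sub_ne_zero.2 huw); linear_combination hu - hw
  have h3 : a*(u+v+w)+b = 0 := by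
    apply mul_left_cancel₀ (sub_ne_zero.2 hvw); linear_combination h1 - h2
  have : a*x^3+b*x^2+c*x+d = a*((x-u)*((x-v)*(x-w))) := by
    linear_combination hu + (x-u)*h1 + (x-u)*(x-v)*h3
  rw [this]
  have := sub_pos.2 xu
  have := sub_pos.2 xv
  have := sub_pos.2 xw
  positivity

theorem lt_I_iff (A B K I : ℝ) (hA : 0 < A) (hK : 0 < K) :
    I < K * (1 - B / A) ↔ 0 < A * (1 - I / K) - B := by
  have : A * (1 - I / K) - B = (A / K) * (K * (1 - B / A) - I) := by
    field_simp
    ring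
  rw [this, mul_pos_iff_of_pos_left (by positivity), sub_pos]

theorem analytic_aux (A B C E K L : ℝ) (hA : 0 < A) (hB : 0 < B) (hC : 0 < C) (hE : 0 < E)
    (hK : 0 < K) (hL : 0 < L) (hBA : B < A) (hEC : E < C) (m : ℝ)
    (hm : m = min (K * (1 - B / A)) (K * (1 - E / C))) :
    ∃ Y0 : ℝ, 0 < Y0 ∧
      (∀ Y, Y0 < Y → ∀ I ∈ Ioo (0:ℝ) m,
        I * (A * (1 - I / K) - B) * (C * (1 - I / K) - E) ≠ L * (1 - I / K) * Y) ∧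
      (∀ Y, 0 < Y → Y < Y0 → ∃ u v : ℝ, u ≠ v ∧
        {I | I ∈ Ioo (0:ℝ) m ∧
          I * (A * (1 - I / K) - B) * (C * (1 - I / K) - E) = L * (1 - I / K) * Y} = {u, v}) := by
  have hlt : ∀ I, I < m ↔ 0 < A * (1 - I / K) - B ∧ 0 < C * (1 - I / K) - E := by
    intro I
    rw [hm, lt_min_iff, lt_I_iff _ _ _ _ hA hK, lt_I_iff _ _ _ _ hC hK]
  have hm0 : 0 < m := by
    rw [hlt]; simp [hBA, hEC]
  have hmK : m < K := by
    have : m ≤ K * (1 - B / A) := by rw [hm]; exact min_le_left _ _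
    have h2 : K * (B / A) > 0 := by positivity
    linarith
  have hmz : (A * (1 - m / K) - B) * (C * (1 - m / K) - E) = 0 := by
    rcases min_choice (K * (1 - B / A)) (K * (1 - E / C)) with h | h
    · rw [← hm] at h
      have : A * (1 - m / K) - B = 0 := by rw [h]; field_simp; ring
      rw [this, zero_mul]
    · rw [← hm] at h
      have : C * (1 - m / K) - E = 0 := by rw [h]; field_simp; ring
      rw [this, mul_zero]
  have ht : ∀ I, I ≤ m → 0 < 1 - I / K := by
    intro I hI
    rw [sub_pos, div_lt_one hK]; linarith
  set P : ℝ → ℝ := fun I => I * (A * (1 - I / K) - B) * (C * (1 - I / K) - E) with hP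
  set G : ℝ → ℝ := fun I => P I / (L * (1 - I / K)) with hG
  have hPG : ∀ I, I ≤ m → ∀ Y, P I = L * (1 - I / K) * Y ↔ G I = Y := by
    intro I hI Y
    have := ht I hI
    rw [hG]
    simp only
    rw [div_eq_iff (by positivity), mul_comm Y]
  have hcont : ContinuousOn G (Icc 0 m) := by
    apply ContinuousOn.div
    · rw [hP]; fun_prop
    · fun_prop
    · intro x hx
      have := ht x hx.2
      positivity
  obtain ⟨I0, hI0, hmax⟩ := isCompact_Icc.exists_isMaxOn (nonempty_Icc.2 hm0.le) hcont
  have hG0 : G 0 = 0 := by simp [hG, hP]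
  have hGm : G m = 0 := by
    have : P m = 0 := by rw [hP]; simp only; rw [mul_assoc, hmz, mul_zero]
    simp [hG, this]
  have hpos : 0 < G I0 := by
    have h1 : 0 < G (m/2) := by
      have := ht (m/2) (by linarith)
      obtain ⟨h2, h3⟩ := (hlt (m/2)).1 (by linarith)
      simp only [hG, hP]
      positivity
    exact lt_of_lt_of_le h1 (hmax ⟨by linarith, by linarith⟩)
  refine ⟨G I0, hpos, ?_, ?_⟩
  · intro Y hY I hI h
    have h2 := (hPG I hI.2.le Y).1 h
    have h3 : G I ≤ G I0 := hmax ⟨hI.1.le, hI.2.le⟩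
    linarith
  · intro Y hY hY0
    obtain ⟨u, hu, hGu⟩ := intermediate_value_Ioo hI0.1
      (hcont.mono (Icc_subset_Icc_right hI0.2)) (show Y ∈ Ioo (G 0) (G I0) by rw [hG0]; exact ⟨hY, hY0⟩)
    obtain ⟨v, hv, hGv⟩ := intermediate_value_Ioo' hI0.2
      (hcont.mono (Icc_subset_Icc_left hI0.1)) (show Y ∈ Ioo (G m) (G I0) by rw [hGm]; exact ⟨hY, hY0⟩)
    have hum : u < m := hu.2.trans_le hI0.2
    have huv : u < v := hu.2.trans hv.1
    refine ⟨u, v, huv.ne, ?_⟩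
    have hu' := (hPG u hum.le Y).2 hGu
    have hv' := (hPG v hv.2.le Y).2 hGv
    ext w
    simp only [mem_setOf_eq, mem_insert_iff, mem_singleton_iff]
    constructor
    · rintro ⟨hw, hw'⟩
      by_contra! hne
      have key : ∀ x, P x - L * (1 - x / K) * Y = (A*C/K^2)*x^3 + (-(A/K)*(C-E)-(C/K)*(A-B))*x^2
          + ((A-B)*(C-E) + L*Y/K)*x + (-(L*Y)) := by
        intro x
        simp only [hP]; field_simp; ring
      have := cubic_pos_aux (A*C/K^2) (-(A/K)*(C-E)-(C/K)*(A-B)) ((A-B)*(C-E) + L*Y/K) (-(L*Y))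
        u v w m (by positivity) huv.ne hne.1.symm hne.2.symm
        (by rw [← key, hu', sub_self]) (by rw [← key, hv', sub_self])
        (by rw [← key]; exact sub_eq_zero.2 hw') hum hv.2 hw.2
      rw [← key] at this
      have h0 : P m = 0 := by rw [hP]; simp only; rw [mul_assoc, hmz, mul_zero]
      have := ht m le_rfl
      have : 0 < L * (1 - m / K) * Y := by positivity
      linarith
    · rintro (rfl | rfl)
      · exact ⟨⟨hu.1, hum⟩, hu'⟩
      · exact ⟨⟨hI0.1.trans_lt hv.1, hv.2⟩, hv'⟩

/-- Under `N₀ > 1` and `Y* < γM*`, there is a threshold `Y_P** > 0` such that: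
(i) for `Y_P > Y_P**` the equation `ψ(I) = η(Y_P, I)` has no root in
`(0, min{I₁, I₂})` and `TE` is the only equilibrium of the controlled male-scarcity
system in ℝ⁴₊; (ii) for `0 < Y_P < Y_P**` the equation has exactly two roots there,
and the system has `TE` and two positive equilibria. -/
theorem controlledScarcity_threshold_YPss
    (b K γ r νI μI νY μY δ μF μM α N0 Istar Ystar Mstar I1 I2 : ℝ)
    (ψ : ℝ → ℝ) (η : ℝ → ℝ → ℝ)
    (hb : 0 < b) (hK : 0 < K) (hγ : 0 < γ) (hr : 0 < r) (hr1 : r < 1)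
    (hνI : 0 < νI) (hμI : 0 < μI) (hνY : 0 < νY) (hμY : 0 < μY)
    (hδ : 0 < δ) (hμF : 0 < μF) (hμM : 0 < μM) (hα : 0 ≤ α)
    (hN0 : N0 = b * r * νI * νY / ((μI + νI) * ((νY + μY) * (δ + μF) - δ * νY)))
    (hgt : 1 < N0)
    (hIs : Istar = (1 - 1 / N0) * K)
    (hYs : Ystar = r * νI * (δ + μF) * Istar / ((νY + μY) * (δ + μF) - δ * νY))
    (hMs : Mstar = (1 - r) * νI * Istar / μM)
    (habund : Ystar < γ * Mstar)
    (hψ : ∀ I, ψ I =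
      I * (νY * γ * (1 - r) * νI * b * (1 - I / K) - (δ + μF) * (νI + μI) * μM) *
        (r * νI * b * (1 - I / K) - μF * (νI + μI)))
    (hη : ∀ YP I, η YP I =
      μY * (δ + μF) * (νI + μI) * (μM + α) * b * (1 - I / K) * YP)
    (hI1 : I1 = K * (1 - (δ + μF) * (νI + μI) * μM / (νY * γ * (1 - r) * νI * b)))
    (hI2 : I2 = K * (1 - μF * (νI + μI) / (r * νI * b))) :
    ∃ YPss : ℝ, 0 < YPss ∧
      (∀ YP : ℝ, YPss < YP →
        (∀ I ∈ Ioo (0 : ℝ) (min I1 I2), ψ I ≠ η YP I) ∧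
        (∀ x ∈ Orthant, cScarce b K γ r νI μI νY μY δ μF μM α YP x = 0 → x = 0)) ∧
      (∀ YP : ℝ, 0 < YP → YP < YPss →
        (∃ u v : ℝ, u ≠ v ∧
          {I | I ∈ Ioo (0 : ℝ) (min I1 I2) ∧ ψ I = η YP I} = {u, v}) ∧
        cScarce b K γ r νI μI νY μY δ μF μM α YP 0 = 0 ∧
        (∃ p q : Fin 4 → ℝ, p ≠ q ∧ (∀ i, 0 < p i) ∧ (∀ i, 0 < q i) ∧
          cScarce b K γ r νI μI νY μY δ μF μM α YP p = 0 ∧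
          cScarce b K γ r νI μI νY μY δ μF μM α YP q = 0)) := by
  have hr2 : 0 < 1 - r := by linarith
  have hD : (νY + μY) * (δ + μF) - δ * νY = νY * μF + μY * (δ + μF) := by ring
  rw [hD] at hN0 hYs
  set D := νY * μF + μY * (δ + μF) with hDdef
  have hDpos : 0 < D := by positivity
  have hN : (μI + νI) * D < b * r * νI * νY := by
    rw [hN0, lt_div_iff₀ (by positivity)] at hgt; linarith
  have hIpos : 0 < Istar := by
    rw [hIs]
    have : 1 / N0 < 1 := by rw [div_lt_one (by linarith)]; exact hgt
    exact mul_pos (by linarith) hK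
  have hab : r * (δ + μF) * μM < γ * (1 - r) * D := by
    have e1 : Ystar = (r * (δ + μF) * μM) * (νI * Istar / (D * μM)) := by
      rw [hYs]; field_simp
    have e2 : γ * Mstar = (γ * (1 - r) * D) * (νI * Istar / (D * μM)) := by
      rw [hMs]; field_simp
    rw [e1, e2] at habund
    exact lt_of_mul_lt_mul_right habund (by positivity)
  have hEC : μF * (νI + μI) < r * νI * b := by
    have h1 : (μI + νI) * (νY * μF) < b * r * νI * νY := by
      refine lt_of_le_of_lt ?_ hN
      apply mul_le_mul_of_nonneg_left _ (by positivity)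
      rw [hDdef]
      have : 0 < μY * (δ + μF) := by positivity
      linarith
    apply lt_of_mul_lt_mul_right _ hνY.le
    linarith
  have hBA : (δ + μF) * (νI + μI) * μM < νY * γ * (1 - r) * νI * b := by
    have h1 := mul_lt_mul_of_pos_right hab (show 0 < νI + μI by positivity)
    have h2 := mul_lt_mul_of_pos_left hN (show 0 < γ * (1 - r) by positivity)
    apply lt_of_mul_lt_mul_left _ hr.le
    linarith
  have hηL : ∀ YP I, η YP I =
      (μY * (δ + μF) * (νI + μI) * (μM + α) * b) * (1 - I / K) * YP := hη
  have hm' : ∀ I, I < min I1 I2 ↔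
      0 < νY * γ * (1 - r) * νI * b * (1 - I / K) - (δ + μF) * (νI + μI) * μM ∧
      0 < r * νI * b * (1 - I / K) - μF * (νI + μI) := by
    intro I
    rw [lt_min_iff, hI1, hI2, lt_I_iff _ _ _ _ (by positivity) hK,
      lt_I_iff _ _ _ _ (by positivity) hK]
  obtain ⟨Y0, hY0, hA1, hA2⟩ := analytic_aux (νY * γ * (1 - r) * νI * b)
    ((δ + μF) * (νI + μI) * μM) (r * νI * b) (μF * (νI + μI)) K
    (μY * (δ + μF) * (νI + μI) * (μM + α) * b) (by positivity) (by positivity)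
    (by positivity) (by positivity) hK (by positivity) hBA hEC (min I1 I2) (by rw [hI1, hI2])
  have hψη : ∀ YP I, (ψ I = η YP I ↔ I * (νY * γ * (1 - r) * νI * b * (1 - I / K) - (δ + μF) * (νI + μI) * μM) *
        (r * νI * b * (1 - I / K) - μF * (νI + μI)) =
      (μY * (δ + μF) * (νI + μI) * (μM + α) * b) * (1 - I / K) * YP) := by
    intro YP I; rw [hψ, hη]
  have hequil : ∀ YP, 0 < YP → ∀ I ∈ Ioo (0:ℝ) (min I1 I2), ψ I = η YP I →
      ∃ p : Fin 4 → ℝ, p 0 = I ∧ (∀ i, 0 < p i) ∧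
        cScarce b K γ r νI μI νY μY δ μF μM α YP p = 0 := by
    intro YP hYP I hI h
    rw [hψη] at h
    obtain ⟨hξ, hφ⟩ := (hm' I).1 hI.2
    have hI0 := hI.1
    have ht : 0 < 1 - I / K := by
      by_contra! hc
      have := mul_nonpos_of_nonneg_of_nonpos (show 0 ≤ r * νI * b by positivity) hc
      have : 0 < μF * (νI + μI) := by positivity
      linarith
    generalize hte : 1 - I / K = t at *
    obtain ⟨F, hF⟩ : ∃ F, F = (νI + μI) * I / (b * t) := ⟨_, rfl⟩
    obtain ⟨Y, hY⟩ : ∃ Y, Y = I * (r * νI * b * t - μF * (νI + μI)) / (μY * b * t) := ⟨_, rfl⟩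
    have hFp : 0 < F := by rw [hF]; positivity
    have hYp : 0 < Y := by rw [hY]; positivity
    obtain ⟨M, hM⟩ : ∃ M, M = (δ + μF) * F * (Y + YP) / (νY * γ * Y) := ⟨_, rfl⟩
    have hMp : 0 < M := by rw [hM]; positivity
    have e1 : b * t * F = (νI + μI) * I := by rw [hF]; field_simp
    have e2 : μY * Y = r * νI * I - μF * F := by rw [hY, hF]; field_simp
    have e3 : νY * γ * M * Y / (Y + YP) = (δ + μF) * F := by rw [hM]; field_simp
    have e4 : Y * (νY * γ * (1 - r) * νI * b * t - (δ + μF) * (νI + μI) * μM) =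
        (μM + α) * YP * (δ + μF) * (νI + μI) := by
      rw [hY, div_mul_eq_mul_div, div_eq_iff (by positivity)]
      linear_combination h
    have e5 : (1 - r) * νI * I * (νY * γ * Y) = (μM * (Y + YP) + α * YP) * ((δ + μF) * F) := by
      apply mul_left_cancel₀ (show b * t ≠ 0 by positivity)
      linear_combination I * e4 - (μM * (Y + YP) + α * YP) * (δ + μF) * e1
    have e6 : (μM + α * YP / (Y + YP)) * M = (1 - r) * νI * I := by
      have : (μM + α * YP / (Y + YP)) * M = (μM * (Y + YP) + α * YP) * ((δ + μF) * F) / (νY * γ * Y) := by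
        rw [hM]; field_simp
      rw [this, ← e5]; field_simp
    refine ⟨![I, Y, F, M], rfl, ?_, ?_⟩
    · intro i
      fin_cases i
      · exact hI0
      · exact hYp
      · exact hFp
      · exact hMp
    · ext i
      fin_cases i
      · show b * (1 - I / K) * F - (νI + μI) * I = 0
        rw [hte]; linarith
      · show r * νI * I - νY * γ * M * Y / (Y + YP) + δ * F - μY * Y = 0
        rw [e3]; linarith
      · show νY * γ * M * Y / (Y + YP) - (δ + μF) * F = 0
        rw [e3]; linarith
      · show (1 - r) * νI * I - (μM + α * YP / (Y + YP)) * M = 0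
        rw [e6]; linarith
  refine ⟨Y0, hY0, ?_, ?_⟩
  · intro YP hYP
    have hno : ∀ I ∈ Ioo (0 : ℝ) (min I1 I2), ψ I ≠ η YP I := by
      intro I hI h
      exact hA1 YP hYP I hI ((hψη YP I).1 h)
    refine ⟨hno, ?_⟩
    intro x hx hc
    have hYPp : 0 < YP := hY0.trans hYP
    obtain ⟨I, hIe⟩ : ∃ I, I = x 0 := ⟨_, rfl⟩
    obtain ⟨Y, hYe⟩ : ∃ Y, Y = x 1 := ⟨_, rfl⟩
    obtain ⟨F, hFe⟩ : ∃ F, F = x 2 := ⟨_, rfl⟩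
    obtain ⟨M, hMe⟩ : ∃ M, M = x 3 := ⟨_, rfl⟩
    have c0 : b * (1 - I / K) * F - (νI + μI) * I = 0 := by
      rw [hIe, hFe]; exact congrFun hc 0
    have c1 : r * νI * I - νY * γ * M * Y / (Y + YP) + δ * F - μY * Y = 0 := by
      rw [hIe, hFe, hYe, hMe]; exact congrFun hc 1
    have c2 : νY * γ * M * Y / (Y + YP) - (δ + μF) * F = 0 := by
      rw [hFe, hYe, hMe]; exact congrFun hc 2
    have c3 : (1 - r) * νI * I - (μM + α * YP / (Y + YP)) * M = 0 := by
      rw [hIe, hYe, hMe]; exact congrFun hc 3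
    have nI : 0 ≤ I := hIe ▸ hx 0
    have nY : 0 ≤ Y := hYe ▸ hx 1
    have nF : 0 ≤ F := hFe ▸ hx 2
    have nM : 0 ≤ M := hMe ▸ hx 3
    have hS : 0 < Y + YP := by positivity
    rcases nI.eq_or_lt with hI0 | hI0
    · have hI0 : I = 0 := hI0.symm
      have hM0 : M = 0 := by
        rw [hI0] at c3
        have hp : 0 < μM + α * YP / (Y + YP) := by positivity
        have : (μM + α * YP / (Y + YP)) * M = 0 := by linarith
        exact (mul_eq_zero.1 this).resolve_left hp.ne'
      have hF0 : F = 0 := by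
        rw [hM0] at c2
        have : (δ + μF) * F = 0 := by
          simp only [mul_zero, zero_mul, zero_div] at c2; linarith
        exact (mul_eq_zero.1 this).resolve_left (by positivity)
      have hY0' : Y = 0 := by
        have : μY * Y = 0 := by
          rw [hI0, hM0, hF0] at c1
          simp only [mul_zero, zero_mul, zero_div] at c1; linarith
        exact (mul_eq_zero.1 this).resolve_left hμY.ne'
      ext i
      fin_cases i
      · exact hIe.symm.trans hI0
      · exact hYe.symm.trans hY0'
      · exact hFe.symm.trans hF0
      · exact hMe.symm.trans hM0
    · exfalso
      generalize hte : 1 - I / K = t at *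
      have htF : 0 < (b * t) * F := by
        have : 0 < (νI + μI) * I := by positivity
        linarith
      have hFp : 0 < F := by
        rcases nF.eq_or_lt with h | h
        · rw [← h] at htF; simp at htF
        · exact h
      have ht : 0 < t := by
        have := (pos_iff_pos_of_mul_pos htF).2 hFp
        exact (mul_pos_iff_of_pos_left hb).1 this
      have d2 : νY * γ * M * Y = (δ + μF) * F * (Y + YP) := by
        rw [sub_eq_zero, div_eq_iff hS.ne'] at c2; exact c2
      have hYp : 0 < Y := by
        rcases nY.eq_or_lt with h | h
        · rw [← h] at d2
          have : 0 < (δ + μF) * F * (0 + YP) := by positivity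
          linarith
        · exact h
      have d3 : (1 - r) * νI * I * (Y + YP) = (μM * (Y + YP) + α * YP) * M := by
        have : (μM + α * YP / (Y + YP)) * M = (μM * (Y + YP) + α * YP) * M / (Y + YP) := by
          field_simp
        rw [this, sub_eq_zero, eq_div_iff hS.ne'] at c3; exact c3
      have d1 : μY * Y = r * νI * I - μF * F := by linarith
      have d0 : b * t * F = (νI + μI) * I := by linarith
      have f1 : μY * b * t * Y = I * (r * νI * b * t - μF * (νI + μI)) := by
        linear_combination b * t * d1 - μF * d0
      have d5 : (1 - r) * νI * I * (νY * γ * Y) = (μM * (Y + YP) + α * YP) * ((δ + μF) * F) := by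
        apply mul_right_cancel₀ hS.ne'
        linear_combination (νY * γ * Y) * d3 + (μM * (Y + YP) + α * YP) * d2
      have f2 : Y * (νY * γ * (1 - r) * νI * b * t - (δ + μF) * (νI + μI) * μM) =
          (μM + α) * YP * (δ + μF) * (νI + μI) := by
        apply mul_left_cancel₀ hI0.ne'
        linear_combination b * t * d5 + (μM * (Y + YP) + α * YP) * (δ + μF) * d0
      have hφ : 0 < r * νI * b * t - μF * (νI + μI) := by
        rw [← mul_pos_iff_of_pos_left hI0, ← f1]; positivity
      have hξ : 0 < νY * γ * (1 - r) * νI * b * t - (δ + μF) * (νI + μI) * μM := by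
        rw [← mul_pos_iff_of_pos_left hYp, f2]; positivity
      refine hno I ⟨hI0, (hm' I).2 ?_⟩ ((hψη YP I).2 ?_)
      · rw [hte]; exact ⟨hξ, hφ⟩
      · rw [hte]
        linear_combination μY * b * t * f2 - (νY * γ * (1 - r) * νI * b * t - (δ + μF) * (νI + μI) * μM) * f1
  · intro YP hYP hlt
    obtain ⟨u, v, huv, hset⟩ := hA2 YP hYP hlt
    have hset' : {I | I ∈ Ioo (0 : ℝ) (min I1 I2) ∧ ψ I = η YP I} = {u, v} := by
      rw [← hset]; ext I; simp only [mem_setOf_eq, hψη]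
    refine ⟨⟨u, v, huv, hset'⟩, ?_, ?_⟩
    · ext i; fin_cases i <;> simp [cScarce]
    · have hu : u ∈ {I | I ∈ Ioo (0 : ℝ) (min I1 I2) ∧ ψ I = η YP I} := by rw [hset']; simp
      have hv : v ∈ {I | I ∈ Ioo (0 : ℝ) (min I1 I2) ∧ ψ I = η YP I} := by rw [hset']; simp
      obtain ⟨p, hp0, hp, hpc⟩ := hequil YP hYP u hu.1 hu.2
      obtain ⟨q, hq0, hq, hqc⟩ := hequil YP hYP v hv.1 hv.2
      refine ⟨p, q, ?_, hp, hq, hpc, hqc⟩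
      rintro rfl
      exact huv (hp0.symm.trans hq0)
end
end
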